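/- arXiv:1701.00362 — 2 statements merged into one kernel-verified Lean document; each statement's English description precedes it below -/
import Mathlib

section
/- Let M be a matroid on {1,…,n} and let B, B' be two distinct bases of M. Then the segment with endpoints e_B and e_{B'} is an edge (one-dimensional face) of the matroid base polytope P(M) if and only if there exist elements α, β with B \ B' = {α} and B' \ B = {β} (equivalently, e_B − e_{B'} = e_α − e_β for distinct standard basis vectors e_α, e_β). -/
/-- A nonempty collection of finite sets forms the bases of a matroid if it satisfies
the base exchange axiom. -/
def IsMatroidBases {α : Type*} [DecidableEq α] (Bs : Set (Finset α)) : Prop :=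
  Bs.Nonempty ∧ ∀ B ∈ Bs, ∀ B' ∈ Bs, B ≠ B' → ∀ x ∈ B \ B',
    ∃ y ∈ B' \ B, insert y (B.erase x) ∈ Bs

/-- The 0/1 indicator vector in `ℝ^n` of a subset `B` of `Fin n`. -/
def ind' {n : ℕ} (B : Finset (Fin n)) : Fin n → ℝ := fun i => if i ∈ B then 1 else 0

/-- `F` is a face of `S`: a convex subset such that whenever a point of `F` lies in
the open segment between two points of `S`, both endpoints lie in `F`. -/
def IsFace {n : ℕ} (S F : Set (Fin n → ℝ)) : Prop :=
  F ⊆ S ∧ Convex ℝ F ∧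
    ∀ x ∈ S, ∀ y ∈ S, ∀ z ∈ openSegment ℝ x y, z ∈ F → x ∈ F ∧ y ∈ F

/-- The dimension of the affine hull of a set in `ℝ^n`. -/
noncomputable def fdim {n : ℕ} (F : Set (Fin n → ℝ)) : ℕ :=
  Module.finrank ℝ (affineSpan ℝ F).direction

theorem ind'_injective {n : ℕ} : Function.Injective (ind' (n := n)) := by
  intro A B h
  ext i
  have := congrFun h i
  simp only [ind'] at this
  split_ifs at this <;> simp_all

theorem sum_ind' {n : ℕ} (B : Finset (Fin n)) : ∑ i, ind' B i = B.card := by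
  simp [ind']

theorem ind'_mem_Icc {n : ℕ} (B : Finset (Fin n)) (i : Fin n) : ind' B i ∈ Set.Icc (0 : ℝ) 1 := by
  simp only [ind']
  split_ifs <;> simp

theorem fdim_segment {n : ℕ} {x y : Fin n → ℝ} (h : x ≠ y) : fdim (segment ℝ x y) = 1 := by
  rw [fdim, ← convexHull_pair, affineSpan_convexHull, direction_affineSpan, vectorSpan_pair]
  exact finrank_span_singleton (sub_ne_zero.2 h)

namespace IsMatroidBases

variable {α : Type*} [DecidableEq α] {Bs : Set (Finset α)}

/-- A collection of finite sets satisfying the exchange axiom is the collection of bases of a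
matroid on the whole type. -/
theorem exists_matroid [Finite α] (hM : IsMatroidBases Bs) :
    ∃ M : Matroid α, M.E = Set.univ ∧ ∀ B : Finset α, M.IsBase ↑B ↔ B ∈ Bs := by
  refine ⟨Matroid.ofIsBaseOfFinite (E := Set.univ) Set.finite_univ
    (fun S => ∃ T ∈ Bs, (T : Set α) = S) ?_ ?_ fun _ _ => Set.subset_univ _, rfl, ?_⟩
  · have ⟨B, hB⟩ := hM.1
    exact ⟨B, B, hB, rfl⟩
  · rintro _ _ ⟨A, hA, rfl⟩ ⟨B, hB, rfl⟩ a ha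
    have ha' : a ∈ A \ B := by simpa using ha
    have hne : A ≠ B := by
      rintro rfl
      simp at ha'
    obtain ⟨b, hb, hmem⟩ := hM.2 A hA B hB hne a ha'
    exact ⟨b, by simpa using hb, _, hmem, by simp⟩
  · intro B
    exact ⟨fun ⟨T, hT, h⟩ => Finset.coe_injective h ▸ hT, fun h => ⟨B, h, rfl⟩⟩

/-- Any two bases have the same cardinality. -/
theorem card_eq [Finite α] (hM : IsMatroidBases Bs) {B B' : Finset α} (hB : B ∈ Bs)
    (hB' : B' ∈ Bs) : B.card = B'.card := by
  obtain ⟨M, -, hbase⟩ := hM.exists_matroid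
  simpa using ((hbase B).2 hB).ncard_eq_ncard_of_isBase ((hbase B').2 hB')

/-- The symmetric basis exchange property. -/
theorem symmetric_exchange [Finite α] (hM : IsMatroidBases Bs) {B B' : Finset α} (hB : B ∈ Bs)
    (hB' : B' ∈ Bs) {x : α} (hx : x ∈ B) (hx' : x ∉ B') :
    ∃ y, y ∈ B' ∧ y ∉ B ∧ insert y (B.erase x) ∈ Bs ∧ insert x (B'.erase y) ∈ Bs := by
  obtain ⟨M, hE, hbase⟩ := hM.exists_matroid
  have hMB := (hbase B).2 hB
  have hMB' := (hbase B').2 hB'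
  have hxE : x ∈ M.E := hE ▸ Set.mem_univ x
  have hcirc := hMB'.fundCircuit_isCircuit hxE (by simpa using hx')
  have hxC := M.mem_fundCircuit x ↑B'
  have hxcl := hcirc.mem_closure_sdiff_singleton_of_mem hxC
  have hxB : x ∉ M.closure (↑B \ {x}) := hMB.indep.notMem_closure_sdiff_of_mem (by simpa using hx)
  have hsub : ¬ M.fundCircuit x ↑B' \ {x} ⊆ M.closure (↑B \ {x}) := fun h =>
    hxB (M.closure_subset_closure_of_subset_closure h hxcl)
  obtain ⟨y, ⟨hyC, hyx⟩, hycl⟩ := Set.not_subset.1 hsub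
  have hyx' : y ≠ x := hyx
  have hyE : y ∈ M.E := hE ▸ Set.mem_univ y
  have hyB' : y ∈ B' := by
    simpa [hyx'] using M.fundCircuit_subset_insert x ↑B' hyC
  have hyB : y ∉ B := fun h => hycl
    (M.subset_closure _ (by simp [hE]) ⟨by simpa using h, hyx⟩)
  refine ⟨y, hyB', hyB, (hbase _).1 ?_, (hbase _).1 ?_⟩
  · simpa using hMB.exchange_base_of_notMem_closure (by simpa using hx) hycl hyE
  · have hind := (hMB'.indep.mem_fundCircuit_iff (by rwa [hMB'.closure_eq])
      (by simpa using hx')).1 hyC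
    have := hMB'.exchange_isBase_of_indep' (by simpa using hyB') (by simpa using hx') hind
    rw [← Set.insert_sdiff_singleton_comm hyx'.symm] at this
    simpa using this

/-- Points of the base polytope lie in the unit cube and have coordinate sum equal to the rank. -/
theorem mem_convexHull {n : ℕ} {Bs : Set (Finset (Fin n))} (hM : IsMatroidBases Bs)
    {B : Finset (Fin n)} (hB : B ∈ Bs) {z : Fin n → ℝ} (hz : z ∈ convexHull ℝ (ind' '' Bs)) :
    (∀ i, z i ∈ Set.Icc (0 : ℝ) 1) ∧ ∑ i, z i = ∑ i, ind' B i := by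
  refine convexHull_min (t := {z | (∀ i, z i ∈ Set.Icc (0 : ℝ) 1) ∧ ∑ i, z i = ∑ i, ind' B i})
    ?_ ?_ hz
  · rintro _ ⟨A, hA, rfl⟩
    exact ⟨ind'_mem_Icc A, by rw [sum_ind', sum_ind', hM.card_eq hA hB]⟩
  · rintro u ⟨hu, hu'⟩ v ⟨hv, hv'⟩ a b ha hb hab
    refine ⟨fun i => convex_Icc (0 : ℝ) 1 (hu i) (hv i) ha hb hab, ?_⟩
    simp only [Pi.add_apply, Pi.smul_apply, smul_eq_mul, Finset.sum_add_distrib,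
      ← Finset.mul_sum, hu', hv', ← add_mul, hab, one_mul]

end IsMatroidBases

theorem ind'_add_ind'_exchange {n : ℕ} {B B' : Finset (Fin n)} {x y : Fin n} (hx : x ∈ B)
    (hx' : x ∉ B') (hy : y ∈ B') (hy' : y ∉ B) :
    ind' (insert y (B.erase x)) + ind' (insert x (B'.erase y)) = ind' B + ind' B' := by
  have hxy : x ≠ y := fun h => hy' (h ▸ hx)
  ext i
  simp only [ind', Pi.add_apply, Finset.mem_insert, Finset.mem_erase]
  by_cases h₁ : i = x
  · subst h₁
    simp [*]
  · by_cases h₂ : i = y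
    · subst h₂
      simp [*]
    · simp [h₁, h₂]

/-- An indicator vector on a segment between two indicator vectors is the second endpoint as soon
as it differs from the first one at a coordinate where the endpoints differ. -/
theorem eq_of_ind'_mem_segment {n : ℕ} {A B B' : Finset (Fin n)} {x : Fin n}
    (h : ind' A ∈ segment ℝ (ind' B) (ind' B')) (hx : x ∈ B) (hx' : x ∉ B') (hA : x ∉ A) :
    A = B' := by
  obtain ⟨a, b, -, -, hab, h⟩ := h
  have ha : a = 0 := by simpa [ind', hx, hx', hA] using congrFun h x
  have hb : b = 1 := by linarith
  apply ind'_injective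
  rw [← h, ha, hb, zero_smul, one_smul, zero_add]

/-- The endpoints of `[0, 1]` are extreme: a proper convex combination of points of `[0, 1]`
equal to `0` or `1` is trivial. -/
theorem eq_ind'_of_combo {n : ℕ} {B : Finset (Fin n)} {i : Fin n} {s t a b : ℝ}
    (hs : s ∈ Set.Icc (0 : ℝ) 1) (ht : t ∈ Set.Icc (0 : ℝ) 1) (ha : 0 < a) (hb : 0 < b)
    (hab : a + b = 1) (h : a * s + b * t = ind' B i) : s = ind' B i := by
  obtain ⟨hs₀, hs₁⟩ := hs
  obtain ⟨ht₀, ht₁⟩ := ht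
  simp only [ind'] at h ⊢
  split_ifs at h ⊢
  · nlinarith
  · nlinarith

theorem mem_segment_of_eq_off_pair {n : ℕ} {B B' : Finset (Fin n)} {α β : Fin n}
    (hα : B \ B' = {α}) (hβ : B' \ B = {β}) {x : Fin n → ℝ}
    (hx : ∀ i, x i ∈ Set.Icc (0 : ℝ) 1) (hsum : ∑ i, x i = ∑ i, ind' B i)
    (hoff : ∀ i, i ≠ α → i ≠ β → x i = ind' B i) :
    x ∈ segment ℝ (ind' B) (ind' B') := by
  have h₁ := Finset.ext_iff.1 hα
  have h₂ := Finset.ext_iff.1 hβ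
  simp only [Finset.mem_sdiff, Finset.mem_singleton] at h₁ h₂
  obtain ⟨hαB, hαB'⟩ := (h₁ α).2 rfl
  obtain ⟨hβB', hβB⟩ := (h₂ β).2 rfl
  have hne : α ≠ β := fun h => hβB (h ▸ hαB)
  have hpair : x α + x β = 1 := by
    have hzero : ∑ i, (x i - ind' B i) = 0 := by rw [Finset.sum_sub_distrib, hsum, sub_self]
    rw [Fintype.sum_eq_add α β hne fun i hi => by rw [hoff i hi.1 hi.2, sub_self]] at hzero
    simp only [ind', hαB, hβB, if_true, if_false] at hzero
    linarith
  refine ⟨x α, x β, (hx α).1, (hx β).1, hpair, ?_⟩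
  ext i
  simp only [Pi.add_apply, Pi.smul_apply, smul_eq_mul]
  by_cases hiα : i = α
  · subst hiα
    simp [ind', hαB, hαB']
  by_cases hiβ : i = β
  · subst hiβ
    simp [ind', hβB, hβB']
  have hBB' : ind' B' i = ind' B i := by
    have := h₁ i
    have := h₂ i
    simp only [ind']
    grind
  rw [hBB', hoff i hiα hiβ, ← add_mul, hpair, one_mul]

/-- For two distinct bases `B`, `B'` of a matroid, the segment between `e_B` and
`e_{B'}` is an edge of the matroid base polytope if and only if `B \ B'` and
`B' \ B` are singletons. -/
theorem segment_is_edge_iff (n : ℕ) (Bs : Set (Finset (Fin n)))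
    (hM : IsMatroidBases Bs) (B B' : Finset (Fin n))
    (hB : B ∈ Bs) (hB' : B' ∈ Bs) (hne : B ≠ B') :
    (IsFace (convexHull ℝ (ind' '' Bs)) (segment ℝ (ind' B) (ind' B')) ∧
        fdim (segment ℝ (ind' B) (ind' B')) = 1) ↔
      ∃ α β : Fin n, B \ B' = {α} ∧ B' \ B = {β} := by
  constructor
  · rintro ⟨⟨-, -, hface⟩, -⟩
    have hnot : ¬ B ⊆ B' := fun h => hne (Finset.eq_of_subset_of_card_le h
      (hM.card_eq hB' hB).le)
    obtain ⟨x, hx, hx'⟩ := Finset.not_subset.1 hnot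
    obtain ⟨y, hy, hy', h₁, h₂⟩ := hM.symmetric_exchange hB hB' hx hx'
    have hsum := ind'_add_ind'_exchange hx hx' hy hy'
    have hmem := (hface _ (subset_convexHull ℝ _ ⟨_, h₁, rfl⟩) _
      (subset_convexHull ℝ _ ⟨_, h₂, rfl⟩) ((1 / 2 : ℝ) • (ind' B + ind' B'))
      ⟨1 / 2, 1 / 2, by norm_num, by norm_num, by norm_num, by rw [← smul_add, hsum]⟩
      ⟨1 / 2, 1 / 2, by norm_num, by norm_num, by norm_num, by rw [← smul_add]⟩).1
    have hxy : x ≠ y := fun h => hy' (h ▸ hx)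
    have heq := eq_of_ind'_mem_segment hmem hx hx' (by simp [hxy])
    refine ⟨x, y, ?_, ?_⟩ <;> rw [← heq] <;> ext i <;>
      simp only [Finset.mem_sdiff, Finset.mem_insert, Finset.mem_erase,
        Finset.mem_singleton] <;> grind
  · rintro ⟨α, β, hα, hβ⟩
    refine ⟨⟨?_, convex_segment _ _, ?_⟩, fdim_segment (ind'_injective.ne hne)⟩
    · exact segment_subset_convexHull ⟨B, hB, rfl⟩ ⟨B', hB', rfl⟩
    have key := fun z (hz : z ∈ convexHull ℝ (ind' '' Bs)) => hM.mem_convexHull hB hz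
    have hBB' : ∀ i, i ≠ α → i ≠ β → ind' B i = ind' B' i := fun i hiα hiβ => by
      have h₁ := Finset.ext_iff.1 hα i
      have h₂ := Finset.ext_iff.1 hβ i
      simp only [Finset.mem_sdiff, Finset.mem_singleton] at h₁ h₂
      simp only [ind']
      grind
    rintro x hx y hy z ⟨a, b, ha, hb, hab, rfl⟩ hz
    have aux : ∀ x y : Fin n → ℝ, x ∈ convexHull ℝ (ind' '' Bs) →
        y ∈ convexHull ℝ (ind' '' Bs) → ∀ a b : ℝ, 0 < a → 0 < b → a + b = 1 →
        a • x + b • y ∈ segment ℝ (ind' B) (ind' B') → x ∈ segment ℝ (ind' B) (ind' B') := by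
      intro x y hx hy a b ha hb hab hz
      refine mem_segment_of_eq_off_pair hα hβ (key x hx).1 (key x hx).2 fun i hiα hiβ => ?_
      obtain ⟨c, d, -, -, hcd, hz⟩ := hz
      have hzi := congrFun hz i
      simp only [Pi.add_apply, Pi.smul_apply, smul_eq_mul, ← hBB' i hiα hiβ, ← add_mul, hcd,
        one_mul] at hzi
      exact eq_ind'_of_combo ((key x hx).1 i) ((key y hy).1 i) ha hb hab hzi.symm
    exact ⟨aux x y hx hy a b ha hb hab hz,
      aux y x hy hx b a hb ha (by rwa [add_comm]) (by rwa [add_comm])⟩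
end

section
/- The class of lattice path matroids is closed under contraction: if M is a lattice path matroid on a ground set E (i.e., M is isomorphic to M[P,Q] for some lattice paths P never going above Q with common endpoints) and S ⊆ E, then the contraction M/S, the matroid on E \ S with bases {B \ S : B a basis of M with |B ∩ S| = r(S)} where r(S) is the maximum of |B ∩ S| over bases B, is again a lattice path matroid. -/
/-- Number of North steps among the first `i` steps of the lattice path `P`
(steps are indexed `1, …, n`; `P j = true` means step `j` is a North step). -/
def NCt (P : ℕ → Bool) (i : ℕ) : ℕ :=
  ((Finset.Icc 1 i).filter (fun j => P j = true)).card

/-- `P` is a lattice path from `(0,0)` to `(m,r)`: it has exactly `r` North steps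
among its `m + r` steps. -/
def IsPath (m r : ℕ) (P : ℕ → Bool) : Prop := NCt P (m + r) = r

/-- `P` never goes above `Q`. -/
def Below (n : ℕ) (P Q : ℕ → Bool) : Prop := ∀ i ≤ n, NCt P i ≤ NCt Q i

/-- `B` is a basis of the lattice path matroid `M[P,Q]`: an `r`-element subset of
`{1, …, m+r}` whose associated lattice path stays between `P` and `Q`. -/
def IsLPBasis (m r : ℕ) (P Q : ℕ → Bool) (B : Finset ℕ) : Prop :=
  B ⊆ Finset.Icc 1 (m + r) ∧ B.card = r ∧
    ∀ i ≤ m + r, NCt P i ≤ (B.filter (fun j => j ≤ i)).card ∧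
      (B.filter (fun j => j ≤ i)).card ≤ NCt Q i

/-- `Bs` (the set of bases of a matroid on ground set `E`) is a lattice path
matroid: there are bounding lattice paths `P`, `Q` and a bijection from `E` to
`{1,…,m+r}` carrying the bases onto the bases of `M[P,Q]`. -/
def IsLatticePathMatroid {E : Type*} (Bs : Set (Finset E)) : Prop :=
  ∃ (m r : ℕ) (P Q : ℕ → Bool), IsPath m r P ∧ IsPath m r Q ∧ Below (m + r) P Q ∧
    ∃ φ : E → ℕ, Set.BijOn φ Set.univ ↑(Finset.Icc 1 (m + r)) ∧
      ∀ B : Finset E, B ∈ Bs ↔ IsLPBasis m r P Q (B.image φ)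

theorem NCt_succ (P : ℕ → Bool) (i : ℕ) :
    NCt P (i + 1) = NCt P i + if P (i + 1) = true then 1 else 0 := by
  unfold NCt
  rw [← Finset.insert_Icc_right_eq_Icc_add_one (by omega), Finset.filter_insert]
  split_ifs with h
  · rw [Finset.card_insert_of_notMem (by simp)]
  · rfl

/-- A function with steps in `{0, 1}` counts the North steps of a lattice path. -/
theorem NCt_decide_lt {f : ℕ → ℕ} (h0 : f 0 = 0)
    (hf : ∀ i, f i ≤ f (i + 1) ∧ f (i + 1) ≤ f i + 1) (i : ℕ) :
    NCt (fun j => decide (f (j - 1) < f j)) i = f i := by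
  induction i with
  | zero => simp [NCt, h0]
  | succ i ih =>
    rw [NCt_succ, ih]
    have := hf i
    simp only [Nat.add_sub_cancel, decide_eq_true_eq]
    split_ifs <;> omega

theorem card_filter_le_succ (X : Finset ℕ) (i : ℕ) :
    (X.filter (fun j => j ≤ i + 1)).card =
      (X.filter (fun j => j ≤ i)).card + if i + 1 ∈ X then 1 else 0 := by
  have : X.filter (fun j => j ≤ i + 1) =
      X.filter (fun j => j ≤ i) ∪ X.filter (fun j => j = i + 1) := by
    ext j
    simp only [Finset.mem_filter, Finset.mem_union]
    grind
  rw [this, Finset.card_union_of_disjoint]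
  · congr 1
    rw [Finset.filter_eq']
    split_ifs <;> simp
  · rw [Finset.disjoint_left]
    simp only [Finset.mem_filter]
    grind

theorem card_filter_insert_erase {X : Finset ℕ} {e f : ℕ} (he : e ∉ X) (hf : f ∈ X) (i : ℕ) :
    ((insert e (X.erase f)).filter (fun j => j ≤ i)).card + (if f ≤ i then 1 else 0) =
      (X.filter (fun j => j ≤ i)).card + if e ≤ i then 1 else 0 := by
  have h1 : (insert e X).filter (fun j => j ≤ i) =
      (insert f (insert e (X.erase f))).filter (fun j => j ≤ i) := by
    congr 1
    ext j
    simp only [Finset.mem_insert, Finset.mem_erase]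
    grind
  have h2 : ((insert e X).filter (fun j => j ≤ i)).card =
      (X.filter (fun j => j ≤ i)).card + if e ≤ i then 1 else 0 := by
    rw [Finset.filter_insert]
    split_ifs
    · rw [Finset.card_insert_of_notMem (by simp [he])]
    · rfl
  rw [← h2, h1, Finset.filter_insert (fun j => j ≤ i) f]
  split_ifs
  · rw [Finset.card_insert_of_notMem]
    simp only [Finset.mem_filter, Finset.mem_insert, Finset.mem_erase]
    grind
  · rfl

theorem card_filter_le_zero {n : ℕ} {X : Finset ℕ} (hX : X ⊆ Finset.Icc 1 n) :
    (X.filter (fun j => j ≤ 0)).card = 0 := by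
  rw [Finset.card_eq_zero, Finset.filter_eq_empty_iff]
  intro j hj
  have := Finset.mem_Icc.1 (hX hj)
  omega

theorem card_filter_le_top {n : ℕ} {X : Finset ℕ} (hX : X ⊆ Finset.Icc 1 n) :
    (X.filter (fun j => j ≤ n)).card = X.card := by
  rw [Finset.filter_true_of_mem fun j hj => (Finset.mem_Icc.1 (hX hj)).2]

/-- Basis exchange: an element of a basis `A` can be put into a basis `B`. -/
theorem IsLPBasis.exchange {m r : ℕ} {P Q : ℕ → Bool} {A B : Finset ℕ}
    (hA : IsLPBasis m r P Q A) (hB : IsLPBasis m r P Q B) {e : ℕ} (heA : e ∈ A) (heB : e ∉ B) :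
    ∃ f ∈ B, f ∉ A ∧ IsLPBasis m r P Q (insert e (B.erase f)) := by
  obtain ⟨hA1, hA2, hA3⟩ := hA
  obtain ⟨hB1, hB2, hB3⟩ := hB
  have he := Finset.mem_Icc.1 (hA1 heA)
  suffices H : ∃ f ∈ B, f ∉ A ∧ ∀ i ≤ m + r,
      (e ≤ i → i < f → (B.filter (fun j => j ≤ i)).card < (A.filter (fun j => j ≤ i)).card) ∧
      (f ≤ i → i < e → (A.filter (fun j => j ≤ i)).card < (B.filter (fun j => j ≤ i)).card) by
    obtain ⟨f, hfB, hfA, H⟩ := H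
    refine ⟨f, hfB, hfA, ?_, ?_, ?_⟩
    · exact Finset.insert_subset (hA1 heA) ((Finset.erase_subset _ _).trans hB1)
    · rw [Finset.card_insert_of_notMem (by simp [heB]), Finset.card_erase_add_one hfB, hB2]
    · intro i hi
      have h1 := card_filter_insert_erase heB hfB i
      have h2 := hA3 i hi
      have h3 := hB3 i hi
      have h4 := H i hi
      split_ifs at h1 <;> omega
  obtain ⟨e, rfl⟩ : ∃ k, e = k + 1 := ⟨e - 1, by omega⟩
  have ha := card_filter_le_succ A e
  have hb := card_filter_le_succ B e
  rw [if_pos heA] at ha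
  rw [if_neg heB] at hb
  by_cases hlt : (B.filter (fun j => j ≤ e + 1)).card < (A.filter (fun j => j ≤ e + 1)).card
  · have hex : ∃ i, e + 1 ≤ i ∧
        (A.filter (fun j => j ≤ i)).card ≤ (B.filter (fun j => j ≤ i)).card := by
      refine ⟨m + r, he.2, ?_⟩
      rw [card_filter_le_top hA1, card_filter_le_top hB1, hA2, hB2]
    classical
    obtain ⟨hf1, hf2⟩ := Nat.find_spec hex
    have hmin := fun i => Nat.find_min (m := i) hex
    set f := Nat.find hex
    have hne : f ≠ e + 1 := by
      intro h
      rw [h] at hf2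
      omega
    obtain ⟨f', hf'⟩ : ∃ k, f = k + 1 := ⟨f - 1, by omega⟩
    have h1 := hmin f' (by omega)
    have ha' := card_filter_le_succ A f'
    have hb' := card_filter_le_succ B f'
    rw [← hf'] at ha' hb'
    refine ⟨f, ?_, ?_, ?_⟩
    · by_contra h
      rw [if_neg h] at hb'
      omega
    · intro h
      rw [if_pos h] at ha'
      split_ifs at hb' <;> omega
    · intro i _
      refine ⟨fun h h' => ?_, by omega⟩
      have := hmin i h'
      omega
  · let p : ℕ → Prop := fun i =>
      (B.filter (fun j => j ≤ i)).card ≤ (A.filter (fun j => j ≤ i)).card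
    have hp0 : p 0 := by
      change _ ≤ _
      rw [card_filter_le_zero hA1, card_filter_le_zero hB1]
    classical
    have hspec : p (Nat.findGreatest p e) := Nat.findGreatest_spec (Nat.zero_le e) hp0
    have hle : Nat.findGreatest p e ≤ e := Nat.findGreatest_le e
    have hmax : ∀ i, Nat.findGreatest p e < i → i ≤ e → ¬ p i :=
      fun i h h' => Nat.findGreatest_is_greatest h h'
    set k := Nat.findGreatest p e
    have hne : k ≠ e := by
      intro h
      rw [h] at hspec
      change _ ≤ _ at hspec
      omega
    have h1 := hmax (k + 1) (by omega) (by omega)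
    change _ ≤ _ at hspec
    change ¬ (_ ≤ _) at h1
    have ha' := card_filter_le_succ A k
    have hb' := card_filter_le_succ B k
    refine ⟨k + 1, ?_, ?_, ?_⟩
    · by_contra h
      rw [if_neg h] at hb'
      omega
    · intro h
      rw [if_pos h] at ha'
      split_ifs at hb' <;> omega
    · intro i _
      refine ⟨by omega, fun h h' => ?_⟩
      have h2 : ¬ (_ ≤ _) := hmax i (by omega) (by omega)
      omega

/-- Sets of a given size whose prefix counts are subject to arbitrary bounds form a lattice path
matroid. -/
theorem isLatticePathMatroid_of_bounds {E : Type*} [Finite E] (φ : E → ℕ)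
    (hφ : Function.Injective φ) (r N : ℕ) (l u : ℕ → ℕ) (Bs : Set (Finset E))
    (hne : Bs.Nonempty)
    (hBs : ∀ B, B ∈ Bs ↔ B.card = r ∧ ∀ i ≤ N, l i ≤ (B.filter (fun x => φ x ≤ i)).card ∧
      (B.filter (fun x => φ x ≤ i)).card ≤ u i) :
    IsLatticePathMatroid Bs := by
  classical
  have := Fintype.ofFinite E
  let k : ℕ → ℕ := fun i => (Finset.univ.filter (fun y => φ y ≤ i)).card
  have hk : ∀ i, k i ≤ Fintype.card E := fun i => Finset.card_le_univ _
  let ψ : E → ℕ := fun x => k (φ x)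
  have hψk : ∀ x i, φ x ≤ i ↔ ψ x ≤ k i := by
    intro x i
    constructor
    · intro h
      apply Finset.card_le_card
      intro y
      simp only [Finset.mem_filter, Finset.mem_univ, true_and]
      exact fun h' => h'.trans h
    · intro h
      by_contra! h'
      refine absurd h (not_le.2 (Finset.card_lt_card ?_))
      refine Finset.ssubset_iff_of_subset ?_ |>.2 ⟨x, by simp, by simpa using h'⟩
      intro y
      simp only [Finset.mem_filter, Finset.mem_univ, true_and]
      omega
  have hψ : Function.Injective ψ := by
    intro x y h
    exact hφ (le_antisymm ((hψk x (φ y)).2 h.le) ((hψk y (φ x)).2 h.ge))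
  have hmaps : ∀ x, ψ x ∈ Finset.Icc 1 (Fintype.card E) := by
    intro x
    rw [Finset.mem_Icc]
    exact ⟨Finset.card_pos.2 ⟨x, by simp⟩, hk _⟩
  have hbij : Set.BijOn ψ Set.univ ↑(Finset.Icc 1 (Fintype.card E)) := by
    refine ⟨fun x _ => hmaps x, hψ.injOn, ?_⟩
    have := Finset.surjOn_of_injOn_of_card_le (s := Finset.univ)
      (t := Finset.Icc 1 (Fintype.card E)) ψ (fun x _ => hmaps x) hψ.injOn (by simp)
    simpa using this
  let c : Finset E → ℕ → ℕ := fun B i => ((B.image ψ).filter (fun j => j ≤ i)).card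
  have hsub : ∀ B : Finset E, B.image ψ ⊆ Finset.Icc 1 (Fintype.card E) := by
    intro B
    rw [Finset.image_subset_iff]
    exact fun x _ => hmaps x
  have hck : ∀ (B : Finset E) i, (B.filter (fun x => φ x ≤ i)).card = c B (k i) := by
    intro B i
    simp only [c]
    rw [Finset.filter_image, Finset.card_image_of_injective _ hψ]
    simp only [hψk]
  have hc0 : ∀ B, c B 0 = 0 := fun B => card_filter_le_zero (hsub B)
  have hctop : ∀ B, c B (Fintype.card E) = B.card := fun B => by
    rw [← Finset.card_image_of_injective B hψ]
    exact card_filter_le_top (hsub B)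
  have hcs : ∀ B i, c B i ≤ c B (i + 1) ∧ c B (i + 1) ≤ c B i + 1 := by
    intro B i
    have h : c B (i + 1) = c B i + _ := card_filter_le_succ (B.image ψ) i
    split_ifs at h <;> omega
  have hF : (Set.toFinite Bs).toFinset.Nonempty := by simpa using hne
  have hmem : ∀ B, B ∈ (Set.toFinite Bs).toFinset ↔ B ∈ Bs := by simp
  have hlo : ∃ p : ℕ → ℕ, (∀ i, ∃ B ∈ Bs, p i = c B i) ∧ ∀ i, ∀ B ∈ Bs, p i ≤ c B i := by
    refine ⟨fun i => (Set.toFinite Bs).toFinset.inf' hF (fun B => c B i), fun i => ?_,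
      fun i B hB => Finset.inf'_le _ ((hmem B).2 hB)⟩
    obtain ⟨B, hB, h⟩ := Finset.exists_mem_eq_inf' hF (fun B => c B i)
    exact ⟨B, (hmem B).1 hB, h⟩
  have hup : ∃ q : ℕ → ℕ, (∀ i, ∃ B ∈ Bs, q i = c B i) ∧ ∀ i, ∀ B ∈ Bs, c B i ≤ q i := by
    refine ⟨fun i => (Set.toFinite Bs).toFinset.sup' hF (fun B => c B i), fun i => ?_,
      fun i B hB => Finset.le_sup' (fun B => c B i) ((hmem B).2 hB)⟩
    obtain ⟨B, hB, h⟩ := Finset.exists_mem_eq_sup' hF (fun B => c B i)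
    exact ⟨B, (hmem B).1 hB, h⟩
  obtain ⟨p, hpa, hp⟩ := hlo
  obtain ⟨q, hqa, hq⟩ := hup
  have hval : ∀ g : ℕ → ℕ, (∀ i, ∃ B ∈ Bs, g i = c B i) → g 0 = 0 ∧ g (Fintype.card E) = r := by
    intro g hg
    obtain ⟨B, -, h⟩ := hg 0
    obtain ⟨B', hB', h'⟩ := hg (Fintype.card E)
    exact ⟨h.trans (hc0 B), h'.trans ((hctop B').trans ((hBs B').1 hB').1)⟩
  have hpc := NCt_decide_lt (hval p hpa).1 fun i => by
    obtain ⟨B, hB, h⟩ := hpa i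
    obtain ⟨B', hB', h'⟩ := hpa (i + 1)
    have h1 := hp i B' hB'
    have h2 := hp (i + 1) B hB
    have h3 := hcs B i
    have h4 := hcs B' i
    omega
  have hqc := NCt_decide_lt (hval q hqa).1 fun i => by
    obtain ⟨B, hB, h⟩ := hqa i
    obtain ⟨B', hB', h'⟩ := hqa (i + 1)
    have h1 := hq i B' hB'
    have h2 := hq (i + 1) B hB
    have h3 := hcs B i
    have h4 := hcs B' i
    omega
  obtain ⟨B₀, hB₀⟩ := hne
  have hr : r ≤ Fintype.card E := ((hBs B₀).1 hB₀).1 ▸ Finset.card_le_univ B₀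
  have hmr : Fintype.card E - r + r = Fintype.card E := by omega
  refine ⟨Fintype.card E - r, r, fun j => decide (p (j - 1) < p j),
    fun j => decide (q (j - 1) < q j), ?_, ?_, ?_, ψ, ?_, ?_⟩
  · rw [IsPath, hpc, hmr, (hval p hpa).2]
  · rw [IsPath, hqc, hmr, (hval q hqa).2]
  · intro i _
    rw [hpc, hqc]
    exact (hp i B₀ hB₀).trans (hq i B₀ hB₀)
  · rwa [hmr]
  · intro B
    unfold IsLPBasis
    simp only [hpc, hqc, hmr]
    rw [Finset.card_image_of_injective B hψ]
    constructor
    · intro hB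
      exact ⟨hsub B, ((hBs B).1 hB).1, fun i _ => ⟨hp i B hB, hq i B hB⟩⟩
    · rintro ⟨-, h1, h2⟩
      rw [hBs]
      refine ⟨h1, fun i hi => ?_⟩
      obtain ⟨h3, h4⟩ := h2 (k i) (hk i)
      obtain ⟨C, hC, hC'⟩ := hpa (k i)
      obtain ⟨D, hD, hD'⟩ := hqa (k i)
      have h5 := (((hBs C).1 hC).2 i hi).1
      have h6 := (((hBs D).1 hD).2 i hi).2
      rw [hck] at h5 h6 ⊢
      exact ⟨(h5.trans hC'.ge).trans h3, h4.trans (hD'.le.trans h6)⟩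

/-- If a family of sets has the basis exchange property, then in a member meeting `S` in as many
elements as possible, the part in `S` may be replaced by that of any other such member. -/
theorem sdiff_union_inter_mem_of_exchange {E : Type*} [DecidableEq E] {Bs : Set (Finset E)}
    (hex : ∀ A ∈ Bs, ∀ B ∈ Bs, ∀ e ∈ A, e ∉ B → ∃ f ∈ B, f ∉ A ∧ insert e (B.erase f) ∈ Bs)
    {S : Finset E} {s : ℕ} (hs : ∀ B ∈ Bs, (B ∩ S).card ≤ s) {A B : Finset E} (hA : A ∈ Bs)
    (hAs : (A ∩ S).card = s) (hB : B ∈ Bs) (hBs : (B ∩ S).card = s) :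
    B \ S ∪ A ∩ S ∈ Bs := by
  induction hn : ((A ∩ S) \ B).card generalizing B with
  | zero =>
    rw [Finset.card_eq_zero, Finset.sdiff_eq_empty_iff_subset] at hn
    have h : A ∩ S = B ∩ S :=
      Finset.eq_of_subset_of_card_le
        (Finset.subset_inter hn Finset.inter_subset_right) (by omega)
    rwa [h, Finset.sdiff_union_inter]
  | succ n ih =>
    obtain ⟨e, he⟩ : ((A ∩ S) \ B).Nonempty := Finset.card_pos.1 (by omega)
    simp only [Finset.mem_sdiff, Finset.mem_inter] at he
    obtain ⟨⟨heA, heS⟩, heB⟩ := he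
    obtain ⟨f, hfB, hfA, hC⟩ := hex A hA B hB e heA heB
    have hfS : f ∈ S := by
      by_contra hfS
      have h : insert e (B.erase f) ∩ S = insert e (B ∩ S) := by
        ext x
        simp only [Finset.mem_inter, Finset.mem_insert, Finset.mem_erase]
        grind
      have h1 := hs _ hC
      rw [h, Finset.card_insert_of_notMem (by simp [heB])] at h1
      omega
    have h1 : insert e (B.erase f) \ S = B \ S := by
      ext x
      simp only [Finset.mem_sdiff, Finset.mem_insert, Finset.mem_erase]
      grind
    have h2 : insert e (B.erase f) ∩ S = insert e ((B ∩ S).erase f) := by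
      ext x
      simp only [Finset.mem_inter, Finset.mem_insert, Finset.mem_erase]
      grind
    have h3 : (A ∩ S) \ insert e (B.erase f) = ((A ∩ S) \ B).erase e := by
      ext x
      simp only [Finset.mem_inter, Finset.mem_sdiff, Finset.mem_insert, Finset.mem_erase]
      grind
    rw [← h1]
    refine ih hC ?_ ?_
    · rw [h2, Finset.card_insert_of_notMem (by simp [heB]),
        Finset.card_erase_add_one (by simp [hfB, hfS]), hBs]
    · rw [h3, Finset.card_erase_of_mem (by simp [heA, heS, heB]), hn, Nat.add_sub_cancel]

/-- The class of lattice path matroids is closed under contraction. -/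
theorem lpm_contraction {E : Type*} [DecidableEq E] (Bs : Set (Finset E))
    (hM : IsLatticePathMatroid Bs) (S : Finset E) (rS : ℕ)
    (hrS : IsGreatest ((fun B => (B ∩ S).card) '' Bs) rS) :
    IsLatticePathMatroid
      {B' : Finset {x // x ∉ S} | ∃ B ∈ Bs, (B ∩ S).card = rS ∧
        B' = (B \ S).subtype (fun x => x ∉ S)} := by
  obtain ⟨m, r, P, Q, -, -, -, φ, hφ, hBs⟩ := hM
  have hinj : Function.Injective φ := Set.injOn_univ.1 hφ.injOn
  have hfin : Finite E :=
    Set.finite_univ_iff.1 (Set.Finite.of_finite_image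
      (hφ.image_eq ▸ Finset.finite_toSet _) hφ.injOn)
  obtain ⟨⟨A, hA, hAs⟩, hub⟩ := hrS
  simp only at hAs
  have hub' : ∀ B ∈ Bs, (B ∩ S).card ≤ rS := fun B hB => hub ⟨B, hB, rfl⟩
  have hex : ∀ A ∈ Bs, ∀ B ∈ Bs, ∀ e ∈ A, e ∉ B →
      ∃ f ∈ B, f ∉ A ∧ insert e (B.erase f) ∈ Bs := by
    intro A hA B hB e heA heB
    obtain ⟨f, hfB, hfA, hf⟩ := ((hBs A).1 hA).exchange ((hBs B).1 hB)
      (Finset.mem_image_of_mem φ heA) (by rwa [hinj.mem_finset_image])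
    obtain ⟨f, hf', rfl⟩ := Finset.mem_image.1 hfB
    refine ⟨f, hf', fun h => hfA (Finset.mem_image_of_mem φ h), ?_⟩
    rwa [hBs, Finset.image_insert, Finset.image_erase hinj]
  have hchar : ∀ B, B ∈ Bs ↔ B.card = r ∧ ∀ i ≤ m + r,
      NCt P i ≤ (B.filter (fun x => φ x ≤ i)).card ∧
      (B.filter (fun x => φ x ≤ i)).card ≤ NCt Q i := by
    intro B
    have hsub : B.image φ ⊆ Finset.Icc 1 (m + r) := by
      rw [Finset.image_subset_iff]
      exact fun x _ => hφ.mapsTo (Set.mem_univ x)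
    rw [hBs, IsLPBasis, Finset.card_image_of_injective _ hinj]
    simp only [Finset.filter_image, Finset.card_image_of_injective _ hinj, hsub, true_and]
  have hAr := (hchar A).1 hA
  have hmem : ∀ B' : Finset {x // x ∉ S},
      (∃ B ∈ Bs, (B ∩ S).card = rS ∧ B' = (B \ S).subtype (fun x => x ∉ S)) ↔
        B'.map (Function.Embedding.subtype _) ∪ A ∩ S ∈ Bs := by
    intro B'
    constructor
    · rintro ⟨B, hB, hBs, rfl⟩
      rw [Finset.subtype_map, Finset.filter_true_of_mem fun x hx => (Finset.mem_sdiff.1 hx).2]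
      exact sdiff_union_inter_mem_of_exchange hex hub' hA hAs hB hBs
    · intro h
      refine ⟨_, h, ?_, ?_⟩
      · rw [← hAs]
        congr 1
        ext x
        simp only [Finset.mem_inter, Finset.mem_union, Finset.mem_map,
          Function.Embedding.subtype_apply]
        grind
      · ext ⟨x, hx⟩
        simp [hx]
  have hcard : ∀ (B' : Finset {x // x ∉ S}) (p : E → Prop) [DecidablePred p],
      ((B'.map (Function.Embedding.subtype _) ∪ A ∩ S).filter p).card =
        (B'.filter (fun x : {x // x ∉ S} => p x)).card + ((A ∩ S).filter p).card := by
    intro B' p _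
    rw [Finset.filter_union, Finset.card_union_of_disjoint, Finset.filter_map, Finset.card_map]
    · rfl
    · rw [Finset.disjoint_left]
      simp only [Finset.mem_filter, Finset.mem_map, Function.Embedding.subtype_apply,
        Finset.mem_inter]
      grind
  have hAle : ∀ i ≤ m + r, ((A ∩ S).filter (fun x => φ x ≤ i)).card ≤ NCt Q i := fun i hi =>
    (Finset.card_le_card (Finset.filter_subset_filter _ Finset.inter_subset_left)).trans
      (hAr.2 i hi).2
  have hrle : rS ≤ r := by
    rw [← hAs, ← hAr.1]
    exact Finset.card_le_card Finset.inter_subset_left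
  refine isLatticePathMatroid_of_bounds (fun x : {x // x ∉ S} => φ x) (hinj.comp Subtype.val_injective)
    (r - rS) (m + r) (fun i => NCt P i - ((A ∩ S).filter (fun x => φ x ≤ i)).card)
    (fun i => NCt Q i - ((A ∩ S).filter (fun x => φ x ≤ i)).card) _ ⟨_, A, hA, hAs, rfl⟩ ?_
  intro B'
  rw [Set.mem_ofPred_eq, hmem, hchar]
  have h := hcard B' (fun _ => True)
  simp only [Finset.filter_true, hAs] at h
  refine and_congr (by omega) (forall₂_congr fun i hi => ?_)
  have h1 := hAle i hi
  rw [hcard]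
  omega
end
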